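/- arXiv:1805.07270 — 2 statements merged into one kernel-verified Lean document; each statement's English description precedes it below -/
import Mathlib

section
/- With the reflected–tiled extension setup (0 < η < 1, R = 2^k r with Rη/2 < r ≤ Rη, φ: Q_{2R} → ℝ Lip(1,1/2) with constant ℓ, φ(0,0) = 0, and φ̃ the reflected–tiled extension of φ in time), assume ‖∇φ‖_{*,Q_{2R}} ≤ C₀η. Then for every 0 < ε < 1 and every parabolic cube Q from the dyadic grid generated by Q_r which is contained in the slab {|x|_∞ < 2R}×ℝ and satisfies r ≤ l(Q) ≤ 2R, one has (1/|Q|)∫_Q |∇φ̃ − (∇φ)_{Q_r}| ≤ C_ε η^{1−ε}, where (∇φ)_{Q_r} is the average of ∇φ over Q_r, l(Q) is the radius of Q, and C_ε depends only on n, C₀ and ε. -/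
open MeasureTheory Set
open scoped ENNReal NNReal RealInnerProductSpace

noncomputable section

/-- `ℝ^m` with the Euclidean norm. -/
abbrev E (m : ℕ) := EuclideanSpace ℝ (Fin m)

namespace Par

/-- Parabolic distance on `ℝ^m × ℝ`. -/
def pdist {m : ℕ} (p q : E m × ℝ) : ℝ := ‖p.1 - q.1‖ + Real.sqrt |p.2 - q.2|

/-- Parabolic norm `‖(x,t)‖ = |x| + |t|^{1/2}`. -/
def pnorm {m : ℕ} (p : E m × ℝ) : ℝ := ‖p.1‖ + Real.sqrt |p.2|

/-- Parabolic ball. -/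
def pball {m : ℕ} (c : E m × ℝ) (r : ℝ) : Set (E m × ℝ) := {p | pdist c p < r}

/-- Parabolic cube `Q_r(c)`. -/
def pcube {m : ℕ} (c : E m × ℝ) (r : ℝ) : Set (E m × ℝ) :=
  {p | (∀ i, |p.1 i - c.1 i| < r) ∧ Real.sqrt |p.2 - c.2| < r}

/-- Parabolic distance to the boundary of `Ω`. -/
def distBd {m : ℕ} (Ω : Set (E m × ℝ)) (p : E m × ℝ) : ℝ :=
  sInf (pdist p '' frontier Ω)

/-- Parabolic diameter of a set. -/
def pdiam {m : ℕ} (S : Set (E m × ℝ)) : ℝ :=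
  sSup ((fun q : (E m × ℝ) × (E m × ℝ) => pdist q.1 q.2) '' (S ×ˢ S))

/-- `φ` is `Lip(1,1/2)` with constant `ℓ` on `S`. -/
def LipPar {m : ℕ} (φ : E m × ℝ → ℝ) (ℓ : ℝ) (S : Set (E m × ℝ)) : Prop :=
  ∀ p ∈ S, ∀ q ∈ S, |φ p - φ q| ≤ ℓ * pdist p q

/-- `g` is the a.e. (spatial) gradient of `φ` on `S`. -/
def IsSpatialGradientOn {m : ℕ} (φ : E m × ℝ → ℝ) (g : E m × ℝ → E m)
    (S : Set (E m × ℝ)) : Prop :=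
  ∀ᵐ p ∂(volume.restrict S), HasGradientAt (fun x => φ (x, p.2)) (g p) p.1

/-- Parabolic BMO bound for `f` on `S`: every parabolic cube contained in `S`
has mean oscillation at most `B`. -/
def BMOleOn {m : ℕ} {V : Type*} [NormedAddCommGroup V] [NormedSpace ℝ V]
    (f : E m × ℝ → V) (S : Set (E m × ℝ)) (B : ℝ) : Prop :=
  ∀ c r, 0 < r → pcube c r ⊆ S →
    ⨍ p in pcube c r, ‖f p - ⨍ q in pcube c r, f q‖ ≤ B

/-- The quantity `|Q_s|⁻¹ ∫_{Q_s} ∫_{I_s} |φ(x,t) − φ(x,τ)|²/|t−τ|² dτ dt dx`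
for the parabolic cube `Q_s = J_s × I_s` centred at `c`. -/
def timeDiffSq {m : ℕ} (φ : E m × ℝ → ℝ) (c : E m × ℝ) (s : ℝ) : ℝ :=
  (volume (pcube c s)).toReal⁻¹ *
    ∫ p in pcube c s, ∫ τ in Set.Ioo (c.2 - s^2) (c.2 + s^2),
      (φ p - φ (p.1, τ))^2 / (p.2 - τ)^2

/-- The spatial direction `e_i` in `ℝ^n × ℝ`. -/
def spDir {n : ℕ} (i : Fin n) : E n × ℝ := (EuclideanSpace.single i 1, 0)

/-- The time direction in `ℝ^n × ℝ`. -/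
def tDir {n : ℕ} : E n × ℝ := (0, 1)

/-- `u` (with spatial weak gradient `du`) is a weak solution of
`u_t = div(A ∇u) + B·∇u` in `Ω`. -/
structure WeakSolution {n : ℕ} (Ω : Set (E n × ℝ))
    (A : E n × ℝ → Fin n → Fin n → ℝ) (B : E n × ℝ → E n)
    (u : E n × ℝ → ℝ) (du : E n × ℝ → E n) : Prop where
  u_loc : ∀ K, K ⊆ Ω → IsCompact K → IntegrableOn (fun p => (u p)^2) K volume
  du_loc : ∀ K, K ⊆ Ω → IsCompact K → IntegrableOn (fun p => ‖du p‖^2) K volume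
  sup_slice : ∀ K : Set (E n), IsCompact K → ∃ M : ℝ, ∀ t : ℝ,
    ∫ X in {X | (X, t) ∈ Ω} ∩ K, (u (X, t))^2 ≤ M
  weak_grad : ∀ ψ : E n × ℝ → ℝ, ContDiff ℝ (⊤ : ℕ∞) ψ → HasCompactSupport ψ →
    tsupport ψ ⊆ Ω → ∀ i : Fin n,
    ∫ p in Ω, u p * fderiv ℝ ψ p (spDir i) = - ∫ p in Ω, du p i * ψ p
  weak_pde : ∀ ψ : E n × ℝ → ℝ, ContDiff ℝ (⊤ : ℕ∞) ψ → HasCompactSupport ψ →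
    tsupport ψ ⊆ Ω →
    ∫ p in Ω, (- u p * fderiv ℝ ψ p tDir
      + ∑ i, ∑ j, A p i j * du p j * fderiv ℝ ψ p (spDir i)
      - ψ p * ∑ i, B p i * du p i) = 0

/-- Uniform ellipticity (a.e. on `Ω`) with constants `lam ≤ Lam`. -/
def UniformlyElliptic {n : ℕ} (Ω : Set (E n × ℝ))
    (A : E n × ℝ → Fin n → Fin n → ℝ) (lam Lam : ℝ) : Prop :=
  ∀ᵐ p ∂(volume.restrict Ω), ∀ ξ : E n,
    lam * ‖ξ‖^2 ≤ ∑ i, ∑ j, A p i j * ξ i * ξ j ∧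
      ∑ i, ∑ j, A p i j * ξ i * ξ j ≤ Lam * ‖ξ‖^2

/-- Bounded measurable matrix coefficients. -/
def BoundedMeasurableCoeff {n : ℕ} (A : E n × ℝ → Fin n → Fin n → ℝ) : Prop :=
  (∀ i j, Measurable fun p => A p i j) ∧ ∃ M : ℝ, ∀ p i j, |A p i j| ≤ M

/-- The `p`-adapted weight `|∇u|²|u|^{p−2}`, with the convention that it
vanishes wherever `∇u` does (`0^{p-2} = ∞` in `ℝ≥0∞` otherwise). -/
def sqW (p : ℝ) (uv gv : ℝ) : ℝ≥0∞ :=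
  if gv = 0 then 0 else (ENNReal.ofReal |gv|) ^ 2 * (ENNReal.ofReal |uv|) ^ (p - 2)

end Par

namespace Par

/-- The reflected–tiled reparametrisation of time: period `4r²`, identity on
`[−r², r²]`, reflection `t ↦ 2r² − t` on `[r², 3r²]`. -/
def tileT (r t : ℝ) : ℝ :=
  let k : ℤ := ⌊(t + r ^ 2) / (4 * r ^ 2)⌋
  let s : ℝ := t - 4 * k * r ^ 2
  if s ≤ r ^ 2 then s else 2 * r ^ 2 - s

/-- The reflected–tiled extension in time of `φ`. -/
def tRef {m : ℕ} (r : ℝ) (φ : E m × ℝ → ℝ) (p : E m × ℝ) : ℝ :=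
  φ (p.1, tileT r p.2)

/-- The reflected–tiled extension in time of a vector-valued function
(e.g. the spatial gradient `∇φ`). -/
def tRefV {m : ℕ} (r : ℝ) (g : E m × ℝ → E m) (p : E m × ℝ) : E m :=
  g (p.1, tileT r p.2)

/-- A parabolic cube of radius `2^z · r` from the dyadic grid generated by the
parabolic cube `Q_r` centred at the origin. -/
def dyadicCube (m : ℕ) (r : ℝ) (z : ℤ) (k : Fin m → ℤ) (j : ℤ) : Set (E m × ℝ) :=
  {p | (∀ i, p.1 i ∈ Set.Ico (2 * ((2:ℝ)^z * r) * k i - r)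
          (2 * ((2:ℝ)^z * r) * k i + 2 * ((2:ℝ)^z * r) - r)) ∧
    p.2 ∈ Set.Ico (2 * ((2:ℝ)^z * r)^2 * j - r^2)
          (2 * ((2:ℝ)^z * r)^2 * j + 2 * ((2:ℝ)^z * r)^2 - r^2)}

/-- A modulus of continuity. -/
def IsModulus (δ : ℝ → ℝ) : Prop := δ 0 = 0 ∧ ContinuousAt δ 0 ∧ ∀ s, 0 ≤ δ s

end Par

open Par

namespace Par

variable {m : ℕ}

/-- The product of the coordinate sets `S i` in space with the set `T` in time. -/
def box (S : Fin m → Set ℝ) (T : Set ℝ) : Set (E m × ℝ) :=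
  {p | (∀ i, p.1 i ∈ S i) ∧ p.2 ∈ T}

lemma box_eq_prod (S : Fin m → Set ℝ) (T : Set ℝ) :
    box S T = (WithLp.ofLp ⁻¹' (univ.pi S) : Set (E m)) ×ˢ T := by
  ext p; simp [box]

lemma measurableSet_box {S : Fin m → Set ℝ} {T : Set ℝ} (hS : ∀ i, MeasurableSet (S i))
    (hT : MeasurableSet T) : MeasurableSet (box S T) := by
  rw [box_eq_prod]
  exact ((PiLp.volume_preserving_ofLp (Fin m)).measurable (MeasurableSet.univ_pi hS)).prod hT

lemma volume_box {S : Fin m → Set ℝ} (T : Set ℝ) (hS : ∀ i, MeasurableSet (S i)) :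
    volume (box S T) = (∏ i, volume (S i)) * volume T := by
  rw [box_eq_prod, Measure.volume_eq_prod, Measure.prod_prod,
    (PiLp.volume_preserving_ofLp (Fin m)).measure_preimage
      (MeasurableSet.univ_pi hS).nullMeasurableSet, volume_pi_pi]

lemma pcube_eq_box (c : E m × ℝ) {r : ℝ} (hr : 0 < r) :
    pcube c r = box (fun i => Ioo (c.1 i - r) (c.1 i + r)) (Ioo (c.2 - r ^ 2) (c.2 + r ^ 2)) := by
  ext p
  simp only [pcube, box, mem_ofPred_eq, mem_Ioo, Real.sqrt_lt' hr, abs_sub_lt_iff]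
  constructor
  · rintro ⟨h, h'⟩
    exact ⟨fun i => ⟨by linarith [(h i).2], by linarith [(h i).1]⟩, by linarith, by linarith⟩
  · rintro ⟨h, h'⟩
    exact ⟨fun i => ⟨by linarith [(h i).2], by linarith [(h i).1]⟩, by linarith, by linarith⟩

lemma measurableSet_pcube (c : E m × ℝ) {r : ℝ} (hr : 0 < r) : MeasurableSet (pcube c r) := by
  rw [pcube_eq_box c hr]
  exact measurableSet_box (fun _ => measurableSet_Ioo) measurableSet_Ioo

lemma isOpen_pcube (c : E m × ℝ) (r : ℝ) : IsOpen (pcube c r) := by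
  have h1 : IsOpen {p : E m × ℝ | ∀ i, |p.1 i - c.1 i| < r} := by
    simp only [ofPred_forall]
    exact isOpen_iInter_of_finite fun i => isOpen_lt (by fun_prop) continuous_const
  have h2 : IsOpen {p : E m × ℝ | Real.sqrt |p.2 - c.2| < r} :=
    isOpen_lt (by fun_prop) continuous_const
  exact h1.inter h2

lemma volume_pcube (c : E m × ℝ) {r : ℝ} (hr : 0 < r) :
    volume (pcube c r) = ENNReal.ofReal ((2 * r) ^ m * (2 * r ^ 2)) := by
  rw [pcube_eq_box c hr, volume_box _ fun _ => measurableSet_Ioo]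
  have h1 : ∀ a b : ℝ, a + b - (a - b) = 2 * b := fun a b => by ring
  simp only [Real.volume_Ioo, h1, Finset.prod_const, Finset.card_univ, Fintype.card_fin]
  rw [← ENNReal.ofReal_pow (by positivity), ← ENNReal.ofReal_mul (by positivity)]

lemma volume_real_pcube (c : E m × ℝ) {r : ℝ} (hr : 0 < r) :
    volume.real (pcube c r) = (2 * r) ^ m * (2 * r ^ 2) := by
  rw [measureReal_def, volume_pcube c hr, ENNReal.toReal_ofReal (by positivity)]

lemma volume_pcube_lt_top (c : E m × ℝ) {r : ℝ} (hr : 0 < r) : volume (pcube c r) < ⊤ := by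
  rw [volume_pcube c hr]; exact ENNReal.ofReal_lt_top

lemma volume_real_dyadicCube (r : ℝ) (hr : 0 < r) (z : ℤ) (k : Fin m → ℤ) (j : ℤ) :
    volume.real (dyadicCube m r z k j) =
      (2 * ((2 : ℝ) ^ z * r)) ^ m * (2 * ((2 : ℝ) ^ z * r) ^ 2) := by
  change volume.real (box _ _) = _
  rw [measureReal_def, volume_box _ fun _ => measurableSet_Ico]
  have h1 : ∀ a b c : ℝ, a + b - c - (a - c) = b := fun a b c => by ring
  simp only [Real.volume_Ico, h1, Finset.prod_const, Finset.card_univ, Fintype.card_fin]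
  rw [ENNReal.toReal_mul, ENNReal.toReal_pow, ENNReal.toReal_ofReal (by positivity),
    ENNReal.toReal_ofReal (by positivity)]

lemma pcube_ae_eq_closedBox (c : E m × ℝ) {r : ℝ} (hr : 0 < r) :
    pcube c r =ᵐ[volume]
      box (fun i => Icc (c.1 i - r) (c.1 i + r)) (Icc (c.2 - r ^ 2) (c.2 + r ^ 2)) := by
  have hv : volume (box (fun i => Icc (c.1 i - r) (c.1 i + r)) (Icc (c.2 - r ^ 2) (c.2 + r ^ 2)))
      = volume (pcube c r) := by
    rw [pcube_eq_box c hr, volume_box _ fun _ => measurableSet_Icc,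
      volume_box _ fun _ => measurableSet_Ioo]
    simp only [Real.volume_Ioo, Real.volume_Icc]
  refine ae_eq_of_subset_of_measure_ge ?_ hv.le (measurableSet_pcube c hr).nullMeasurableSet
    (hv ▸ (volume_pcube_lt_top c hr).ne)
  rw [pcube_eq_box c hr]
  exact fun p hp => ⟨fun i => Ioo_subset_Icc_self (hp.1 i), Ioo_subset_Icc_self hp.2⟩

lemma tileT_of_mem_Ico {r t : ℝ} (hr : 0 < r) {j : ℤ}
    (ht : t ∈ Ico (2 * r ^ 2 * j - r ^ 2) (2 * r ^ 2 * j + r ^ 2)) :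
    tileT r t = if Even j then t - 2 * r ^ 2 * j else 2 * r ^ 2 * j - t := by
  have hr2 : 0 < r ^ 2 := by positivity
  obtain ⟨h1, h2⟩ := ht
  rcases Int.even_or_odd j with hj | hj
  · rw [if_pos hj]
    obtain ⟨q, rfl⟩ := hj
    push_cast at *
    have hk : ⌊(t + r ^ 2) / (4 * r ^ 2)⌋ = q := by
      rw [Int.floor_eq_iff, le_div_iff₀ (by positivity), div_lt_iff₀ (by positivity)]
      constructor <;> nlinarith
    simp only [tileT, hk]
    rw [if_pos (by linarith)]; ring
  · rw [if_neg (Int.not_even_iff_odd.2 hj)]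
    obtain ⟨q, rfl⟩ := hj
    push_cast at *
    have hk : ⌊(t + r ^ 2) / (4 * r ^ 2)⌋ = q := by
      rw [Int.floor_eq_iff, le_div_iff₀ (by positivity), div_lt_iff₀ (by positivity)]
      constructor <;> nlinarith
    simp only [tileT, hk]
    split_ifs with h
    · have : t = r ^ 2 * (4 * q + 1) := by nlinarith
      rw [this]; ring
    · ring

/-- On a cube of the initial generation, composition with the tiling of time does not increase
integrals over the corresponding cube of the central time strip. -/
lemma lintegral_tile_le {r : ℝ} (hr : 0 < r) (k : Fin m → ℤ) (j : ℤ) (h : E m × ℝ → ℝ≥0∞) :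
    ∫⁻ p in dyadicCube m r 0 k j, h (p.1, tileT r p.2) ≤
      ∫⁻ p in pcube (WithLp.toLp 2 fun i => 2 * r * k i, 0) r, h p := by
  obtain ⟨σ, hσ, hσt⟩ : ∃ σ : ℝ ≃ᵐ ℝ, MeasurePreserving σ volume volume ∧
      ∀ t, σ t = if Even j then t - 2 * r ^ 2 * j else 2 * r ^ 2 * j - t := by
    by_cases hj : Even j
    · exact ⟨MeasurableEquiv.subRight (2 * r ^ 2 * j), measurePreserving_sub_right _ _,
        fun t => (if_pos hj).symm⟩
    · exact ⟨MeasurableEquiv.subLeft (2 * r ^ 2 * j),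
        Measure.measurePreserving_sub_left volume _, fun t => (if_neg hj).symm⟩
  have hF : MeasurePreserving (Prod.map id σ : E m × ℝ → E m × ℝ) volume volume :=
    (MeasurePreserving.id volume).prod hσ
  have hFe : MeasurableEmbedding (Prod.map id σ : E m × ℝ → E m × ℝ) :=
    ((MeasurableEquiv.refl (E m)).prodCongr σ).measurableEmbedding
  have hmem : ∀ p ∈ dyadicCube m r 0 k j,
      p.2 ∈ Ico (2 * r ^ 2 * j - r ^ 2) (2 * r ^ 2 * j + r ^ 2) := by
    rintro p ⟨-, h2⟩
    simp only [zpow_zero, one_mul, mem_Ico] at h2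
    exact ⟨h2.1, by linarith [h2.2]⟩
  have hmeas : MeasurableSet (dyadicCube m r 0 k j) :=
    measurableSet_box (fun _ => measurableSet_Ico) measurableSet_Ico
  rw [setLIntegral_congr (pcube_ae_eq_closedBox _ hr), ← hF.setLIntegral_comp_preimage_emb hFe h (box _ _)]
  calc ∫⁻ p in dyadicCube m r 0 k j, h (p.1, tileT r p.2)
      = ∫⁻ p in dyadicCube m r 0 k j, h (Prod.map id σ p) := by
        refine setLIntegral_congr_fun hmeas fun p hp => ?_
        simp only [Prod.map, id, hσt, tileT_of_mem_Ico hr (hmem p hp)]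
    _ ≤ _ := by
        refine lintegral_mono_set fun p hp => ?_
        have h2 := hmem p hp
        have h1 := hp.1
        simp only [zpow_zero, one_mul, mem_Ico] at h1 h2
        simp only [box, mem_preimage, mem_ofPred_eq, Prod.map, id, mem_Icc, hσt]
        refine ⟨fun i => ⟨by linarith [(h1 i).1], by linarith [(h1 i).2]⟩, ?_⟩
        split_ifs <;> constructor <;> linarith

lemma exists_mem_Ico_subinterval {a w y : ℝ} (hw : 0 < w) {N : ℕ} (hy : y ∈ Ico a (a + N * w)) :
    ∃ l : Fin N, y ∈ Ico (a + l * w) (a + l * w + w) := by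
  have h0 : 0 ≤ (y - a) / w := div_nonneg (by linarith [hy.1]) hw.le
  have hN : ⌊(y - a) / w⌋₊ < N := by
    rw [Nat.floor_lt h0, div_lt_iff₀ hw]; linarith [hy.2]
  refine ⟨⟨_, hN⟩, ?_, ?_⟩
  · have := (le_div_iff₀ hw).1 (Nat.floor_le h0)
    simp only; linarith
  · have := (div_lt_iff₀ hw).1 (Nat.lt_floor_add_one ((y - a) / w))
    simp only; linarith

/-- A dyadic cube is covered by its descendants of the initial generation. -/
lemma dyadicCube_subset_iUnion {r : ℝ} (hr : 0 < r) (N : ℕ) (k : Fin m → ℤ) (j : ℤ) :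
    dyadicCube m r N k j ⊆ ⋃ l : (Fin m → Fin (2 ^ N)) × Fin (4 ^ N),
      dyadicCube m r 0 (fun i => 2 ^ N * k i + l.1 i) (4 ^ N * j + l.2) := by
  rintro p ⟨h1, h2⟩
  have h4 : (4 : ℝ) ^ N = 2 ^ N * 2 ^ N := by rw [← mul_pow]; norm_num
  have hx : ∀ i, ∃ l : Fin (2 ^ N), p.1 i ∈ Ico (2 * ((2 : ℝ) ^ (N : ℤ) * r) * k i - r + l * (2 * r))
      (2 * ((2 : ℝ) ^ (N : ℤ) * r) * k i - r + l * (2 * r) + 2 * r) := fun i => by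
    refine exists_mem_Ico_subinterval (by positivity) ⟨(h1 i).1, (h1 i).2.trans_le (le_of_eq ?_)⟩
    push_cast; rw [zpow_natCast]; ring
  choose l hl using hx
  obtain ⟨l', hl'⟩ : ∃ l : Fin (4 ^ N),
      p.2 ∈ Ico (2 * ((2 : ℝ) ^ (N : ℤ) * r) ^ 2 * j - r ^ 2 + l * (2 * r ^ 2))
      (2 * ((2 : ℝ) ^ (N : ℤ) * r) ^ 2 * j - r ^ 2 + l * (2 * r ^ 2) + 2 * r ^ 2) := by
    refine exists_mem_Ico_subinterval (by positivity) ⟨h2.1, h2.2.trans_le (le_of_eq ?_)⟩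
    push_cast; rw [zpow_natCast, h4]; ring
  refine mem_iUnion.2 ⟨(l, l'), fun i => ?_, ?_⟩
  · have := hl i
    simp only [zpow_natCast, mem_Ico] at this
    simp only [zpow_zero, one_mul, mem_Ico]
    push_cast
    constructor <;> linarith [this.1, this.2]
  · simp only [zpow_natCast, mem_Ico] at hl'
    simp only [zpow_zero, one_mul, mem_Ico]
    push_cast
    rw [h4]
    constructor <;> linarith [hl'.1, hl'.2]

lemma LipPar.continuousOn {φ : E m × ℝ → ℝ} {ℓ : ℝ} {U : Set (E m × ℝ)} (h : LipPar φ ℓ U) :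
    ContinuousOn φ U := by
  intro p hp
  rw [ContinuousWithinAt, tendsto_iff_dist_tendsto_zero]
  have hc : Continuous fun q : E m × ℝ => ℓ * pdist q p := by unfold pdist; fun_prop
  have h0 : Filter.Tendsto (fun q => ℓ * pdist q p) (nhdsWithin p U) (nhds 0) := by
    have := (hc.tendsto p).mono_left (nhdsWithin_le_nhds (s := U))
    simpa [pdist] using this
  refine squeeze_zero' (Filter.Eventually.of_forall fun _ => dist_nonneg) ?_ h0
  filter_upwards [self_mem_nhdsWithin] with q hq
  rw [Real.dist_eq]
  exact h q hq p hp

lemma eventually_slice_mem {U : Set (E m × ℝ)} (hU : IsOpen U) {p : E m × ℝ} (hp : p ∈ U) :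
    ∀ᶠ x in nhds p.1, (x, p.2) ∈ U :=
  (Continuous.prodMk_left p.2).continuousAt.eventually (hU.mem_nhds hp)

lemma IsSpatialGradientOn.norm_le {φ : E m × ℝ → ℝ} {g : E m × ℝ → E m} {ℓ : ℝ} (hℓ : 0 ≤ ℓ)
    {U : Set (E m × ℝ)} (hU : IsOpen U) (hg : IsSpatialGradientOn φ g U) (h : LipPar φ ℓ U) :
    ∀ᵐ p ∂(volume.restrict U), ‖g p‖ ≤ ℓ := by
  filter_upwards [hg, ae_restrict_mem hU.measurableSet] with p hp hpU
  have := hp.hasFDerivAt.le_of_lip' hℓ (by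
    filter_upwards [eventually_slice_mem hU hpU] with x hx
    have := h _ hx _ hpU
    simpa [pdist] using this)
  simpa using this

lemma IsSpatialGradientOn.aestronglyMeasurable {φ : E m × ℝ → ℝ} {g : E m × ℝ → E m}
    {U : Set (E m × ℝ)} (hU : IsOpen U) (hg : IsSpatialGradientOn φ g U)
    (hφ : ContinuousOn φ U) : AEStronglyMeasurable g (volume.restrict U) := by
  classical
  have hm : Measurable (U.piecewise φ fun _ => 0) :=
    hφ.measurable_piecewise continuousOn_const hU.measurableSet
  have hi : ∀ i, AEMeasurable (fun p => g p i) (volume.restrict U) := fun i => by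
    refine aemeasurable_of_tendsto_metrizable_ae Filter.atTop
      (f := fun (n : ℕ) p => (n : ℝ) • (U.piecewise φ (fun _ => 0)
        (p.1 + (n : ℝ)⁻¹ • EuclideanSpace.single i 1, p.2) - U.piecewise φ (fun _ => 0) p))
      (fun n => ?_) ?_
    · have ht : Measurable fun p : E m × ℝ =>
          (p.1 + (n : ℝ)⁻¹ • EuclideanSpace.single i (1 : ℝ), p.2) := by fun_prop
      exact (((hm.comp ht).sub hm).const_smul (n : ℝ)).aemeasurable
    · filter_upwards [hg, ae_restrict_mem hU.measurableSet] with p hp hpU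
      have h1 := (hp.hasFDerivAt.lim_real (EuclideanSpace.single i 1)).comp
        tendsto_natCast_atTop_atTop
      have h2 : (InnerProductSpace.toDual ℝ (E m) (g p)) (EuclideanSpace.single i 1) = g p i := by
        simp [InnerProductSpace.toDual_apply_apply, EuclideanSpace.inner_single_right]
      rw [h2] at h1
      refine h1.congr' ?_
      have h3 : Filter.Tendsto (fun n : ℕ => p.1 + (n : ℝ)⁻¹ • EuclideanSpace.single i (1 : ℝ))
          Filter.atTop (nhds p.1) := by
        have := (tendsto_inv_atTop_nhds_zero_nat (𝕜 := ℝ)).smul_const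
          (EuclideanSpace.single i (1 : ℝ))
        simpa using this.const_add p.1
      filter_upwards [h3.eventually (eventually_slice_mem hU hpU)] with n hn
      simp [piecewise, hn, hpU]
  have h4 : AEMeasurable (fun p => WithLp.ofLp (g p)) (volume.restrict U) :=
    aemeasurable_pi_iff.2 hi
  have h5 : AEMeasurable (fun p => WithLp.toLp 2 (WithLp.ofLp (g p))) (volume.restrict U) :=
    (WithLp.measurable_toLp 2 _).comp_aemeasurable h4
  exact h5.aestronglyMeasurable

lemma IsSpatialGradientOn.integrableOn {φ : E m × ℝ → ℝ} {g : E m × ℝ → E m} {ℓ : ℝ}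
    (hℓ : 0 ≤ ℓ) {U : Set (E m × ℝ)} (hU : IsOpen U) (hUf : volume U < ⊤)
    (hg : IsSpatialGradientOn φ g U) (h : LipPar φ ℓ U) : IntegrableOn g U :=
  IntegrableOn.of_bound hUf (hg.aestronglyMeasurable hU h.continuousOn) ℓ (hg.norm_le hℓ hU h)

lemma norm_setAverage_sub_le {α V : Type*} [MeasurableSpace α] {μ : Measure α}
    [NormedAddCommGroup V] [NormedSpace ℝ V] [CompleteSpace V] {f : α → V} {s t : Set α}
    (hst : s ⊆ t) (ht : μ t ≠ ⊤) (hf : IntegrableOn f t μ) {K : ℝ} (hs : 0 < μ.real s)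
    (hK : μ.real t ≤ K * μ.real s) (a : V) :
    ‖(⨍ x in s, f x ∂μ) - a‖ ≤ K * ⨍ x in t, ‖f x - a‖ ∂μ := by
  have hsf : μ s ≠ ⊤ := ne_top_of_le_ne_top ht (measure_mono hst)
  have hs0 : μ s ≠ 0 := fun h => by simp [measureReal_def, h] at hs
  have hfa : IntegrableOn (fun x => f x - a) t μ := hf.sub (integrableOn_const ht)
  have h1 : (⨍ x in s, f x ∂μ) - a = (μ.real s)⁻¹ • ∫ x in s, (f x - a) ∂μ := by
    rw [integral_sub (hf.mono_set hst) (integrableOn_const hsf), setAverage_eq, smul_sub,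
      setIntegral_const, inv_smul_smul₀ hs.ne']
  have ht0 : 0 < μ.real t := hs.trans_le (measureReal_mono hst ht)
  have h2 : ∫ x in s, ‖f x - a‖ ∂μ ≤ ∫ x in t, ‖f x - a‖ ∂μ :=
    setIntegral_mono_set hfa.norm (Filter.Eventually.of_forall fun _ => norm_nonneg _)
      hst.eventuallyLE
  have h3 : 0 ≤ ∫ x in t, ‖f x - a‖ ∂μ := integral_nonneg fun _ => norm_nonneg _
  rw [h1, norm_smul, norm_inv, Real.norm_of_nonneg hs.le, setAverage_eq, smul_eq_mul, ← mul_assoc]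
  calc (μ.real s)⁻¹ * ‖∫ x in s, (f x - a) ∂μ‖
      ≤ (μ.real s)⁻¹ * ∫ x in t, ‖f x - a‖ ∂μ := by
        gcongr
        exact (norm_integral_le_integral_norm _).trans h2
    _ ≤ K * (μ.real t)⁻¹ * ∫ x in t, ‖f x - a‖ ∂μ := by
        gcongr
        rw [inv_eq_one_div, ← div_eq_mul_inv, div_le_div_iff₀ hs ht0]
        linarith

lemma pcube_subset_pcube {c c' : E m × ℝ} {r r' : ℝ} (h : ∀ i, |c.1 i - c'.1 i| + r ≤ r')
    (ht : c.2 = c'.2) (hr : r ≤ r') : pcube c r ⊆ pcube c' r' := by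
  rintro p ⟨h1, h2⟩
  refine ⟨fun i => ?_, (ht ▸ h2).trans_le hr⟩
  have := abs_sub_le (p.1 i) (c.1 i) (c'.1 i)
  linarith [h i, h1 i]

/-- The averages over a cube and over a central cube of `2 ^ n` times its radius containing it
differ by at most `n` times the mean oscillation, up to a dimensional constant. -/
lemma norm_setAverage_pcube_sub_le {g : E m × ℝ → E m} {L B : ℝ}
    (hg : IntegrableOn g (pcube 0 L)) (hB : BMOleOn g (pcube 0 L) B) (n : ℕ) :
    ∀ (r : ℝ) (c : E m), 0 < r → 2 ^ n * r = L → (∀ i, |c i| + r ≤ L) →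
      ‖(⨍ p in pcube (c, 0) r, g p) - ⨍ p in pcube 0 L, g p‖ ≤ n * (2 ^ (m + 2) * B) := by
  induction n with
  | zero =>
    intro r c hr hL hc
    have hc0 : c = 0 := by
      ext i
      have := hc i
      simpa using (by linarith : |c i| ≤ 0)
    have hrL : r = L := by simpa using hL
    subst hc0 hrL
    change ‖(⨍ p in pcube (0 : E m × ℝ) r, g p) - _‖ ≤ _
    simp
  | succ n ih =>
    intro r c hr hL hc
    have h2n : (1 : ℝ) ≤ 2 ^ n := one_le_pow₀ (by norm_num)
    have hLr : 2 * r ≤ L := by rw [pow_succ] at hL; nlinarith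
    have hLr' : 0 < L - r := by linarith
    set c' : E m := ((L - 2 * r) / (L - r)) • c with hc'
    have hcc : ∀ i, |c i - c' i| + r ≤ 2 * r := fun i => by
      have : c i - c' i = r / (L - r) * c i := by
        simp only [hc', PiLp.smul_apply, smul_eq_mul]; field_simp; ring
      rw [this, abs_mul, abs_of_nonneg (by positivity), div_mul_eq_mul_div]
      have : r * |c i| / (L - r) ≤ r := by
        rw [div_le_iff₀ hLr']
        exact mul_le_mul_of_nonneg_left (by linarith [hc i]) hr.le
      linarith
    have hcL : ∀ i, |c' i| + 2 * r ≤ L := fun i => by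
      have h0 : 0 ≤ L - 2 * r := by linarith
      simp only [hc', PiLp.smul_apply, smul_eq_mul]
      rw [abs_mul, abs_of_nonneg (by positivity), div_mul_eq_mul_div]
      have : (L - 2 * r) * |c i| / (L - r) ≤ L - 2 * r := by
        rw [div_le_iff₀ hLr']
        exact mul_le_mul_of_nonneg_left (by linarith [hc i]) h0
      linarith
    have hsub : pcube ((c', 0) : E m × ℝ) (2 * r) ⊆ pcube 0 L :=
      pcube_subset_pcube (by simpa using hcL) rfl hLr
    have h1 := norm_setAverage_sub_le
      (pcube_subset_pcube (c := (c, 0)) (c' := (c', 0)) hcc rfl (by linarith))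
      (volume_pcube_lt_top _ (by positivity)).ne (hg.mono_set hsub) (K := 2 ^ (m + 2))
      (by rw [volume_real_pcube _ hr]; positivity)
      (by
        rw [volume_real_pcube _ hr, volume_real_pcube _ (by positivity : 0 < 2 * r)]
        rw [mul_pow 2 (2 * r)]; apply le_of_eq; ring)
      (⨍ p in pcube (c', 0) (2 * r), g p)
    have h2 := hB (c', 0) (2 * r) (by positivity) hsub
    have h3 := ih (2 * r) c' (by positivity) (by rw [← hL]; ring) hcL
    have h4 := norm_sub_le_norm_sub_add_norm_sub (⨍ p in pcube (c, 0) r, g p)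
      (⨍ p in pcube (c', 0) (2 * r), g p) (⨍ p in pcube 0 L, g p)
    have h5 : (2 : ℝ) ^ (m + 2) * ⨍ p in pcube (c', 0) (2 * r),
        ‖g p - ⨍ q in pcube (c', 0) (2 * r), g q‖ ≤ 2 ^ (m + 2) * B := by gcongr
    push_cast
    linarith

lemma lintegral_pcube_sub_le {g : E m × ℝ → E m} {L B : ℝ}
    (hg : IntegrableOn g (pcube 0 L)) (hB : BMOleOn g (pcube 0 L) B) (n : ℕ) {r : ℝ} {c : E m}
    (hr : 0 < r) (hL : 2 ^ n * r = L) (hc : ∀ i, |c i| + r ≤ L) :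
    ∫⁻ p in pcube (c, 0) r, ENNReal.ofReal ‖g p - ⨍ q in pcube 0 r, g q‖ ≤
      ENNReal.ofReal ((B + 2 * (n * (2 ^ (m + 2) * B))) * ((2 * r) ^ m * (2 * r ^ 2))) := by
  have hrL : r ≤ L := hL ▸ le_mul_of_one_le_left hr.le (one_le_pow₀ (by norm_num))
  have hsub : pcube ((c, 0) : E m × ℝ) r ⊆ pcube 0 L :=
    pcube_subset_pcube (by simpa using hc) rfl hrL
  have hgi : IntegrableOn g (pcube (c, 0) r) := hg.mono_set hsub
  have hf := (volume_pcube_lt_top ((c, 0) : E m × ℝ) hr).ne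
  have h1 := norm_setAverage_pcube_sub_le hg hB n r c hr hL hc
  have h2 := norm_setAverage_pcube_sub_le hg hB n r 0 hr hL (by simpa using fun _ => hrL)
  have h3 := hB (c, 0) r hr hsub
  rw [show ((0 : E m), (0 : ℝ)) = 0 from rfl, norm_sub_rev] at h2
  set a := ⨍ q in pcube (c, 0) r, g q
  set b := ⨍ q in pcube 0 r, g q
  have h4 := norm_sub_le_norm_sub_add_norm_sub a (⨍ p in pcube 0 L, g p) b
  have hv : 0 < volume.real (pcube ((c, 0) : E m × ℝ) r) := by
    rw [volume_real_pcube _ hr]; positivity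
  have hga : IntegrableOn (fun p => ‖g p - a‖) (pcube (c, 0) r) :=
    (hgi.sub (integrableOn_const hf)).norm
  have hgb : IntegrableOn (fun p => ‖g p - b‖) (pcube (c, 0) r) :=
    (hgi.sub (integrableOn_const hf)).norm
  rw [← ofReal_integral_eq_lintegral_ofReal hgb
    (Filter.Eventually.of_forall fun _ => norm_nonneg _)]
  apply ENNReal.ofReal_le_ofReal
  rw [setAverage_eq, smul_eq_mul, inv_mul_le_iff₀ hv] at h3
  calc ∫ p in pcube (c, 0) r, ‖g p - b‖ ≤ ∫ p in pcube (c, 0) r, (‖g p - a‖ + ‖a - b‖) :=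
        setIntegral_mono hgb (hga.add (integrableOn_const hf)) fun p =>
          norm_sub_le_norm_sub_add_norm_sub _ _ _
    _ = (∫ p in pcube (c, 0) r, ‖g p - a‖) + volume.real (pcube (c, 0) r) * ‖a - b‖ := by
        rw [integral_add hga (integrableOn_const hf), setIntegral_const, smul_eq_mul]
    _ ≤ volume.real (pcube (c, 0) r) * B +
        volume.real (pcube (c, 0) r) * (2 * (n * (2 ^ (m + 2) * B))) := by
        gcongr; linarith
    _ = _ := by rw [volume_real_pcube _ hr]; ring

lemma setAverage_tile_le {g : E m × ℝ → E m} {L B : ℝ} (hB0 : 0 ≤ B)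
    (hg : IntegrableOn g (pcube 0 L)) (hB : BMOleOn g (pcube 0 L) B) (n : ℕ) {r : ℝ}
    (hr : 0 < r) (hL : 2 ^ n * r = L) (N : ℕ) (k : Fin m → ℤ) (j : ℤ)
    (hsub : dyadicCube m r N k j ⊆ {p : E m × ℝ | ∀ i, |p.1 i| < L}) :
    ⨍ p in dyadicCube m r N k j, ‖tRefV r g p - ⨍ q in pcube 0 r, g q‖ ≤
      B + 2 * (n * (2 ^ (m + 2) * B)) := by
  set b := ⨍ q in pcube 0 r, g q
  set ρ : ℝ := (2 : ℝ) ^ (N : ℤ) * r with hρ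
  have hρ0 : 0 < ρ := by positivity
  have hρN : ρ = 2 ^ N * r := by rw [hρ, zpow_natCast]
  have hcorner : ∀ s ∈ Ico 0 (2 * ρ), ∀ i, |2 * ρ * k i - r + s| < L := fun s hs i =>
    hsub (a := (WithLp.toLp 2 fun i => 2 * ρ * k i - r + s, 2 * ρ ^ 2 * j - r ^ 2))
      ⟨fun i => ⟨by simp only [← hρ]; linarith [hs.1], by simp only; linarith [hs.2]⟩, le_rfl,
        by simp only; nlinarith⟩ i
  have hlow : ∀ i, -L < 2 * ρ * k i - r := fun i => by
    have := (abs_lt.1 (hcorner 0 ⟨le_rfl, by positivity⟩ i)).1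
    linarith
  have hupp : ∀ i, 2 * ρ * k i - r + 2 * ρ ≤ L := fun i => by
    by_contra! hlt
    have h1 := hlow i
    have h2 := (abs_lt.1 (hcorner (max 0 (L - (2 * ρ * k i - r)))
      ⟨le_max_left _ _, max_lt (by positivity) (by linarith)⟩ i)).2
    linarith [le_max_right 0 (L - (2 * ρ * k i - r))]
  have hpiece : ∀ l : (Fin m → Fin (2 ^ N)) × Fin (4 ^ N),
      ∫⁻ p in dyadicCube m r 0 (fun i => 2 ^ N * k i + l.1 i) (4 ^ N * j + l.2),
        ENNReal.ofReal ‖tRefV r g p - b‖ ≤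
      ENNReal.ofReal ((B + 2 * (n * (2 ^ (m + 2) * B))) * ((2 * r) ^ m * (2 * r ^ 2))) := by
    intro l
    refine (lintegral_tile_le hr _ _ fun p => ENNReal.ofReal ‖g p - b‖).trans
      (lintegral_pcube_sub_le hg hB n hr hL fun i => ?_)
    have h1 := hlow i
    have h2 := hupp i
    have h3 : (0 : ℝ) ≤ (l.1 i : ℕ) := by positivity
    have h4 : ((l.1 i : ℕ) : ℝ) + 1 ≤ 2 ^ N := by exact_mod_cast (l.1 i).2
    have h5 := mul_le_mul_of_nonneg_right h4 hr.le
    have h6 := mul_nonneg h3 hr.le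
    rw [hρN] at h1 h2
    simp only
    push_cast
    rw [← le_sub_iff_add_le, abs_le]
    constructor <;> linarith
  have hint : ∫⁻ p in dyadicCube m r N k j, ENNReal.ofReal ‖tRefV r g p - b‖ ≤
      ENNReal.ofReal ((B + 2 * (n * (2 ^ (m + 2) * B))) * ((2 * ρ) ^ m * (2 * ρ ^ 2))) := by
    calc _ ≤ _ := lintegral_mono_set (dyadicCube_subset_iUnion hr N k j)
      _ ≤ _ := lintegral_iUnion_le _ _
      _ ≤ _ := ENNReal.tsum_le_tsum hpiece
      _ = _ := by
        rw [tsum_fintype, Finset.sum_const, ← ENNReal.ofReal_nsmul, nsmul_eq_mul]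
        congr 1
        have h4 : (4 : ℝ) ^ N = 2 ^ N * 2 ^ N := by rw [← mul_pow]; norm_num
        simp only [Finset.card_univ, Fintype.card_prod, Fintype.card_fun, Fintype.card_fin]
        push_cast
        rw [hρN, h4, mul_left_comm 2 (2 ^ N) r, mul_pow (2 ^ N) (2 * r)]
        ring
  rw [setAverage_eq, smul_eq_mul, volume_real_dyadicCube r hr, ← hρ,
    inv_mul_le_iff₀ (by positivity), mul_comm]
  refine (Real.le_norm_self _).trans ((norm_integral_le_lintegral_norm _).trans ?_)
  simp only [norm_norm]
  exact ENNReal.toReal_le_of_le_ofReal (by positivity) hint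

lemma mul_le_rpow_of_two_pow_mul_lt {η ε K : ℝ} (hη : 0 < η) (hη1 : η < 1) (hε : 0 < ε)
    (hK : 0 ≤ K) {k : ℕ} (hk : 2 ^ k * η < 2) :
    (1 + 2 * ((k + 1 : ℕ) * K)) * η ≤ (1 + 4 * K + 4 * K / ε) * η ^ (1 - ε) := by
  have hX : 1 ≤ η⁻¹ ^ ε := Real.one_le_rpow ((one_le_inv₀ hη).2 hη1.le) hε.le
  have hlog := Real.log_le_rpow_div (inv_pos.2 hη).le hε
  have h1 : (2 : ℝ) ^ k ≤ 2 * η⁻¹ := by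
    rw [← div_eq_mul_inv, le_div_iff₀ hη]; exact hk.le
  have h2 := Real.log_le_log (by positivity) h1
  rw [Real.log_pow, Real.log_mul (by norm_num) (inv_pos.2 hη).ne'] at h2
  have h3 := Real.log_two_gt_d9
  set X := η⁻¹ ^ ε with hXdef
  have hXε : 0 ≤ X / ε := by positivity
  have hk' : (k : ℝ) ≤ 1 + 2 * (X / ε) := by
    have : ((k : ℝ) - 1) * Real.log 2 ≤ X / ε := by linarith
    by_contra! hlt
    nlinarith
  have hη' : η ^ (1 - ε) = η * X := by
    rw [Real.rpow_sub hη, Real.rpow_one, hXdef, Real.inv_rpow hη.le, div_eq_mul_inv]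
  rw [hη', mul_comm η X, ← mul_assoc _ X η]
  refine mul_le_mul_of_nonneg_right ?_ hη.le
  push_cast
  have h4 : 2 * (((k : ℝ) + 1) * K) ≤ 2 * ((1 + 2 * (X / ε) + 1) * K) := by gcongr
  have h5 : (1 + 4 * K) * 1 ≤ (1 + 4 * K) * X := by gcongr
  have h6 : (1 + 4 * K + 4 * K / ε) * X = (1 + 4 * K) * X + 4 * (X / ε) * K := by ring
  linarith

end Par

/-- cf. Claim `C:BMO:ext`: in the reflected–tiled extension
setup with `‖∇φ‖_{*,Q_{2R}} ≤ C₀η`, every dyadic parabolic cube `Q` of the grid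
generated by `Q_r` contained in the slab `{|x|_∞ < 2R} × ℝ`, with
`r ≤ l(Q) ≤ 2R`, satisfies `⨍_Q |∇φ̃ − (∇φ)_{Q_r}| ≤ C_ε η^{1−ε}`. -/
theorem stmt6 (m : ℕ) (hm : 1 ≤ m) (C₀ ε : ℝ) (hC₀ : 0 < C₀)
    (hε : 0 < ε) (hε1 : ε < 1) :
    ∃ Cε : ℝ, 0 < Cε ∧
      ∀ (η r R ℓ : ℝ) (k : ℕ) (φ : E m × ℝ → ℝ) (g : E m × ℝ → E m),
        0 < η → η < 1 → 0 < r → 0 ≤ ℓ →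
        R = 2 ^ k * r → R * η / 2 < r → r ≤ R * η →
        LipPar φ ℓ (pcube 0 (2 * R)) → φ 0 = 0 →
        IsSpatialGradientOn φ g (pcube 0 (2 * R)) →
        BMOleOn g (pcube 0 (2 * R)) (C₀ * η) →
        ∀ (z : ℤ) (kk : Fin m → ℤ) (j : ℤ),
          0 ≤ z → (2:ℝ) ^ z * r ≤ 2 * R →
          dyadicCube m r z kk j ⊆ {p : E m × ℝ | ∀ i, |p.1 i| < 2 * R} →
          ⨍ p in dyadicCube m r z kk j,
              ‖tRefV r g p - ⨍ q in pcube 0 r, g q‖ ≤ Cε * η ^ (1 - ε) := by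
  refine ⟨C₀ * (1 + 4 * 2 ^ (m + 2) + 4 * 2 ^ (m + 2) / ε), by positivity, ?_⟩
  intro η r R ℓ k φ g hη hη1 hr hℓ hR hRη _ hφ _ hg hB z kk j hz _ hsub
  lift z to ℕ using hz
  have hR0 : 0 < 2 * R := by rw [hR]; positivity
  have hgi := hg.integrableOn hℓ (isOpen_pcube 0 (2 * R)) (volume_pcube_lt_top 0 hR0) hφ
  have h1 := setAverage_tile_le (by positivity) hgi hB (k + 1) hr (by rw [hR]; ring) z kk j hsub
  have hk : 2 ^ k * η < 2 := by
    rw [hR] at hRη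
    by_contra! hlt
    nlinarith [mul_le_mul_of_nonneg_right hlt hr.le]
  have h2 := mul_le_mul_of_nonneg_left
    (mul_le_rpow_of_two_pow_mul_lt (K := 2 ^ (m + 2)) hη hη1 hε (by positivity) hk) hC₀.le
  refine h1.trans ((le_of_eq ?_).trans (h2.trans (le_of_eq ?_))) <;> ring
end
end

section
/- Let r > 0 and let φ: [−r², r²] → ℝ be a measurable function with η² := sup over subintervals I ⊆ [−r², r²] of (1/|I|)∫_I∫_I |φ(t)−φ(τ)|²/|t−τ|² dτ dt < ∞. Define φ̃: ℝ → ℝ by φ̃(t) = φ(t − 4kr²) for t ∈ [4kr² − r², 4kr² + r²] and φ̃(t) = φ(4kr² + 2r² − t) for t ∈ [4kr² + r², 4kr² + 3r²], k ∈ ℤ. Then there is an absolute constant C such that for every bounded interval A ⊂ ℝ, (1/|A|)∫_A∫_A |φ̃(t)−φ̃(τ)|²/|t−τ|² dτ dt ≤ C η². -/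
open MeasureTheory Set

noncomputable section

/-- The reflected–tiled extension in time of a function `φ : [−r², r²] → ℝ`:
`φ̃(t) = φ(t − 4kr²)` for `t ∈ [4kr² − r², 4kr² + r²]` and
`φ̃(t) = φ(4kr² + 2r² − t)` for `t ∈ [4kr² + r², 4kr² + 3r²]`, `k ∈ ℤ`. -/
def tileReflect (r : ℝ) (φ : ℝ → ℝ) (t : ℝ) : ℝ :=
  let k : ℤ := ⌊(t + r ^ 2) / (4 * r ^ 2)⌋
  let s : ℝ := t - 4 * k * r ^ 2
  if s ≤ r ^ 2 then φ s else φ (2 * r ^ 2 - s)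

/-- The index `k` of the tile `[c + (2k-1)l, c + (2k+1)l)` containing `t`. -/
def tileIndex (c l t : ℝ) : ℤ := ⌊(t - c + l) / (2 * l)⌋

/-- The folding map of the line onto `[c - l, c + l]`. -/
def fold (c l t : ℝ) : ℝ :=
  c + (-1 : ℝ) ^ tileIndex c l t * (t - c - 2 * tileIndex c l t * l)

/-- The half-open tiles of length `2l`. -/
def tile (c l : ℝ) (k : ℤ) : Set ℝ := Ico (c + (2 * k - 1) * l) (c + (2 * k + 1) * l)

lemma mem_tile_iff {c l t : ℝ} (hl : 0 < l) {k : ℤ} : t ∈ tile c l k ↔ tileIndex c l t = k := by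
  unfold tile tileIndex
  rw [Int.floor_eq_iff, le_div_iff₀ (by positivity), div_lt_iff₀ (by positivity), mem_Ico]
  constructor <;> rintro ⟨h1, h2⟩ <;> constructor <;> linarith

lemma fold_eq_of_mem_tile {c l t : ℝ} (hl : 0 < l) {k : ℤ} (ht : t ∈ tile c l k) :
    fold c l t = c + (-1 : ℝ) ^ k * (t - c - 2 * k * l) := by
  rw [fold, (mem_tile_iff hl).1 ht]

lemma fold_eq_of_mem_Icc {c l t : ℝ} (hl : 0 < l) {k : ℤ}
    (ht : t ∈ Icc (c + (2 * k - 1) * l) (c + (2 * k + 1) * l)) :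
    fold c l t = c + (-1 : ℝ) ^ k * (t - c - 2 * k * l) := by
  rcases ht.2.lt_or_eq with h | h
  · exact fold_eq_of_mem_tile hl ⟨ht.1, h⟩
  · have : t ∈ tile c l (k + 1) := by
      rw [h]; constructor <;> push_cast <;> linarith
    rw [fold_eq_of_mem_tile hl this, zpow_add_one₀ (by norm_num), h]
    push_cast; ring

lemma neg_one_zpow_eq_or (k : ℤ) : (-1 : ℝ) ^ k = 1 ∨ (-1 : ℝ) ^ k = -1 := by
  rcases Int.even_or_odd k with h | h
  · exact Or.inl h.neg_one_zpow
  · exact Or.inr h.neg_one_zpow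

lemma fold_eq_self {c l t : ℝ} (hl : 0 < l) (ht : t ∈ Icc (c - l) (c + l)) : fold c l t = t := by
  rw [fold_eq_of_mem_Icc hl (k := 0)]
  · simp
  · constructor <;> push_cast <;> linarith [ht.1, ht.2]

lemma fold_eq_reflect_right {c l t : ℝ} (hl : 0 < l) (ht : t ∈ Icc (c + l) (c + 3 * l)) :
    fold c l t = 2 * (c + l) - t := by
  rw [fold_eq_of_mem_Icc hl (k := 1)]
  · push_cast; rw [zpow_one]; ring
  · constructor <;> push_cast <;> linarith [ht.1, ht.2]

lemma fold_eq_reflect_left {c l t : ℝ} (hl : 0 < l) (ht : t ∈ Icc (c - 3 * l) (c - l)) :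
    fold c l t = 2 * (c - l) - t := by
  rw [fold_eq_of_mem_Icc hl (k := -1)]
  · push_cast; rw [zpow_neg_one]; norm_num; ring
  · constructor <;> push_cast <;> linarith [ht.1, ht.2]

lemma measurable_fold (c l : ℝ) : Measurable (fold c l) := by
  have h : Measurable (tileIndex c l) :=
    Int.measurable_floor.comp (((measurable_id.sub_const c).add_const l).div_const (2 * l))
  have h1 : Measurable fun t => (-1 : ℝ) ^ tileIndex c l t :=
    (measurable_from_top (f := fun k : ℤ => (-1 : ℝ) ^ k)).comp h
  have h2 : Measurable fun t => ((tileIndex c l t : ℤ) : ℝ) :=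
    (measurable_from_top (f := fun k : ℤ => (k : ℝ))).comp h
  unfold fold
  fun_prop

lemma tileReflect_eq_comp_fold {r : ℝ} (hr : 0 < r) (φ : ℝ → ℝ) :
    tileReflect r φ = φ ∘ fold 0 (r ^ 2) := by
  funext t
  have hR : 0 < r ^ 2 := by positivity
  have h1 := Int.floor_le ((t + r ^ 2) / (4 * r ^ 2))
  have h2 := Int.lt_floor_add_one ((t + r ^ 2) / (4 * r ^ 2))
  rw [le_div_iff₀ (by positivity)] at h1
  rw [div_lt_iff₀ (by positivity)] at h2
  simp only [tileReflect, Function.comp]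
  set k := ⌊(t + r ^ 2) / (4 * r ^ 2)⌋
  split_ifs with h
  · rw [fold_eq_of_mem_Icc hR (k := 2 * k) (by push_cast; constructor <;> linarith),
      (even_two_mul k).neg_one_zpow]
    push_cast; congr 1; ring
  · rw [fold_eq_of_mem_Icc hR (k := 2 * k + 1) (by push_cast; constructor <;> linarith),
      (odd_two_mul_add_one k).neg_one_zpow]
    push_cast; congr 1; ring

lemma sq_mul_fold_sub_fold_sq_le_of_le {c l : ℝ} (hl : 0 < l) {t s : ℝ} {j k : ℤ} (hjk : j ≤ k)
    (ht : t ∈ tile c l j) (hs : s ∈ tile c l k) :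
    (1 + ((k - j : ℤ) : ℝ) ^ 2) * (fold c l t - fold c l s) ^ 2 ≤ 5 * (t - s) ^ 2 := by
  obtain ⟨n, rfl⟩ : ∃ n, k = j + n := ⟨k - j, by ring⟩
  rw [fold_eq_of_mem_tile hl ht, fold_eq_of_mem_tile hl hs]
  have hn : 0 ≤ n := by linarith
  obtain ⟨x, hx⟩ : ∃ x, x = t - c - 2 * j * l := ⟨_, rfl⟩
  obtain ⟨y, hy⟩ : ∃ y, y = s - c - 2 * ((j + n : ℤ) : ℝ) * l := ⟨_, rfl⟩
  have hx1 : -l ≤ x := by rw [hx]; linarith [ht.1]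
  have hx2 : x < l := by rw [hx]; linarith [ht.2]
  have hy1 : -l ≤ y := by rw [hy]; linarith [hs.1]
  have hy2 : y < l := by rw [hy]; linarith [hs.2]
  have hD : s - t = y - x + 2 * n * l := by rw [hx, hy]; push_cast; ring
  rw [← hx, ← hy, ← neg_sub s t, neg_sq, add_sub_cancel_left, zpow_add₀ (by norm_num)]
  rcases hn.eq_or_lt with rfl | hn
  · rw [hD]
    rcases neg_one_zpow_eq_or j with h | h <;> rw [h] <;> simp <;> nlinarith [sq_nonneg (y - x)]
  have hn1 : (1 : ℝ) ≤ n := by exact_mod_cast hn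
  obtain ⟨d, hd, hd1, hd2⟩ : ∃ d : ℝ, (c + (-1) ^ j * x - (c + (-1) ^ j * (-1) ^ n * y)) ^ 2 = d ^ 2
      ∧ |d| ≤ 2 * l ∧ |d| ≤ s - t := by
    rcases Int.even_or_odd n with he | ho
    · refine ⟨y - x, ?_, ?_, ?_⟩
      · rw [he.neg_one_zpow]
        rcases neg_one_zpow_eq_or j with h | h <;> rw [h] <;> ring
      · rw [abs_le]; constructor <;> linarith
      · have : (2 : ℝ) ≤ n := by
          have : 2 ≤ n := by obtain ⟨m, rfl⟩ := he; omega
          exact_mod_cast this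
        rw [abs_le]; constructor <;> nlinarith
    · refine ⟨y + x, ?_, ?_, ?_⟩
      · rw [ho.neg_one_zpow]
        rcases neg_one_zpow_eq_or j with h | h <;> rw [h] <;> ring
      · rw [abs_le]; constructor <;> linarith
      · rw [abs_le]; constructor <;> nlinarith
  rw [hd, ← sq_abs d]
  have h0 := abs_nonneg d
  have h3 : n * |d| ≤ 2 * (s - t) := by nlinarith
  have h4 : (n * |d|) ^ 2 ≤ (2 * (s - t)) ^ 2 := by gcongr
  have h5 : |d| ^ 2 ≤ (s - t) ^ 2 := by gcongr
  linarith

lemma sq_mul_fold_sub_fold_sq_le {c l : ℝ} (hl : 0 < l) {t s : ℝ} {j k : ℤ}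
    (ht : t ∈ tile c l j) (hs : s ∈ tile c l k) :
    (1 + ((k - j : ℤ) : ℝ) ^ 2) * (fold c l t - fold c l s) ^ 2 ≤ 5 * (t - s) ^ 2 := by
  rcases le_total j k with h | h
  · exact sq_mul_fold_sub_fold_sq_le_of_le hl h ht hs
  · have := sq_mul_fold_sub_fold_sq_le_of_le hl h hs ht
    push_cast at this ⊢
    linarith [this, show (1 + ((k : ℝ) - j) ^ 2) * (fold c l t - fold c l s) ^ 2
      = (1 + ((j : ℝ) - k) ^ 2) * (fold c l s - fold c l t) ^ 2 by ring]

lemma setLIntegral_tile_comp_fold {c l : ℝ} (hl : 0 < l) (k : ℤ) {h : ℝ → ENNReal}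
    (hh : Measurable h) :
    ∫⁻ t in tile c l k, h (fold c l t) = ∫⁻ x in Ioo (c - l) (c + l), h x := by
  have key : ∀ σ : ℝ → ℝ, MeasurePreserving σ volume volume →
      (∀ t ∈ tile c l k, fold c l t = σ t) →
      σ ⁻¹' Ioo (c - l) (c + l) = Ioo (c + (2 * k - 1) * l) (c + (2 * k + 1) * l) →
      ∫⁻ t in tile c l k, h (fold c l t) = ∫⁻ x in Ioo (c - l) (c + l), h x := by
    intro σ hσ he hp
    rw [← hσ.setLIntegral_comp_preimage measurableSet_Ioo hh, hp,
      setLIntegral_congr (Ioo_ae_eq_Ico (a := c + (2 * k - 1) * l))]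
    exact setLIntegral_congr_fun measurableSet_Ico fun t ht => by rw [he t ht]
  rcases neg_one_zpow_eq_or k with hk | hk
  · refine key (fun t => t - 2 * k * l) (measurePreserving_sub_right volume _) (fun t ht => ?_) ?_
    · rw [fold_eq_of_mem_tile hl ht, hk]; ring
    · rw [preimage_sub_const_Ioo]; congr 1 <;> ring
  · refine key (fun t => (2 * c + 2 * k * l) - t) (Measure.measurePreserving_sub_left volume _)
      (fun t ht => ?_) ?_
    · rw [fold_eq_of_mem_tile hl ht, hk]; ring
    · rw [preimage_const_sub_Ioo]; congr 1 <;> ring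

lemma iUnion_tile {c l : ℝ} (hl : 0 < l) : ⋃ k, tile c l k = univ :=
  eq_univ_of_forall fun t => mem_iUnion.2 ⟨tileIndex c l t, (mem_tile_iff hl).2 rfl⟩

lemma summable_tileWeight : Summable fun n : ℤ => 5 / (1 + (n : ℝ) ^ 2) := by
  have h := ((Real.summable_one_div_int_pow (p := 2)).2 (by norm_num)).mul_left 5
  have h' : Summable fun n : ℤ => if n = 0 then (5 : ℝ) else 0 :=
    (hasSum_ite_eq (0 : ℤ) (5 : ℝ)).summable
  refine Summable.of_nonneg_of_le (fun n => by positivity) (fun n => ?_) (h.add h')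
  by_cases hn : n = 0
  · simp [hn]
  · have : (0 : ℝ) < (n : ℝ) ^ 2 := by positivity
    simp only [hn, if_false, add_zero, mul_one_div]
    gcongr; linarith

/-- The sum of the weights controlling the interaction between tiles. -/
def tileConst : ℝ := ∑' n : ℤ, 5 / (1 + (n : ℝ) ^ 2)

lemma tileConst_pos : 0 < tileConst :=
  summable_tileWeight.tsum_pos (fun n => by positivity) 0 (by norm_num)

/-- The integrand of the double integral, as an extended nonnegative real. -/
def diffKernel (ψ : ℝ → ℝ) (t s : ℝ) : ENNReal := ENNReal.ofReal ((ψ t - ψ s) ^ 2 / (t - s) ^ 2)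

/-- The inner integral of the double integral, as an extended nonnegative real. -/
def innerEnergy (ψ : ℝ → ℝ) (S : Set ℝ) (t : ℝ) : ENNReal := ∫⁻ s in S, diffKernel ψ t s

lemma measurable_diffKernel {ψ : ℝ → ℝ} (hψ : Measurable ψ) :
    Measurable (Function.uncurry (diffKernel ψ)) := by
  unfold diffKernel Function.uncurry
  fun_prop

lemma measurable_innerEnergy {ψ : ℝ → ℝ} (hψ : Measurable ψ) (S : Set ℝ) :
    Measurable (innerEnergy ψ S) :=
  (measurable_diffKernel hψ).lintegral_prod_right'

lemma integral_integral_eq_toReal {ψ : ℝ → ℝ} (hψ : Measurable ψ) (S : Set ℝ) :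
    ∫ t in S, ∫ s in S, (ψ t - ψ s) ^ 2 / (t - s) ^ 2 =
      (∫⁻ t in S, ENNReal.ofReal (innerEnergy ψ S t).toReal).toReal := by
  have h : ∀ t, ∫ s in S, (ψ t - ψ s) ^ 2 / (t - s) ^ 2 = (innerEnergy ψ S t).toReal := by
    intro t
    rw [integral_eq_lintegral_of_nonneg_ae (Filter.Eventually.of_forall fun s => by positivity)]
    · rfl
    · exact Measurable.aestronglyMeasurable (by fun_prop)
  simp_rw [h]
  rw [integral_eq_lintegral_of_nonneg_ae (Filter.Eventually.of_forall fun s => ENNReal.toReal_nonneg)]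
  exact (measurable_innerEnergy hψ S).ennreal_toReal.aestronglyMeasurable

lemma diffKernel_le_mul_diffKernel_fold {c l : ℝ} (hl : 0 < l) (ψ : ℝ → ℝ) {t s : ℝ} {j k : ℤ}
    (ht : t ∈ tile c l j) (hs : s ∈ tile c l k) (hft : ψ (fold c l t) = ψ t)
    (hfs : ψ (fold c l s) = ψ s) :
    diffKernel ψ t s ≤ ENNReal.ofReal (5 / (1 + ((k - j : ℤ) : ℝ) ^ 2)) *
      diffKernel ψ (fold c l t) (fold c l s) := by
  have h := sq_mul_fold_sub_fold_sq_le hl ht hs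
  unfold diffKernel
  rw [← ENNReal.ofReal_mul (by positivity), hft, hfs]
  apply ENNReal.ofReal_le_ofReal
  by_cases he : fold c l t = fold c l s
  · have : ψ t = ψ s := by rw [← hft, ← hfs, he]
    simp [this]
  · have hd : 0 < (fold c l t - fold c l s) ^ 2 := by
      have := sub_ne_zero.2 he
      positivity
    set w : ℝ := 1 + ((k - j : ℤ) : ℝ) ^ 2
    have hw : 0 < w := by positivity
    have hD : 0 < (t - s) ^ 2 := by nlinarith [mul_pos hw hd]
    rw [div_mul_div_comm, div_le_div_iff₀ hD (by positivity)]
    nlinarith [mul_le_mul_of_nonneg_left h (sq_nonneg (ψ t - ψ s))]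

lemma innerEnergy_le_mul_innerEnergy_fold {c l : ℝ} (hl : 0 < l) {ψ : ℝ → ℝ} (hψ : Measurable ψ)
    {A : Set ℝ} (hA : MeasurableSet A) (hf : ∀ t ∈ A, ψ (fold c l t) = ψ t) {t : ℝ} (ht : t ∈ A) :
    innerEnergy ψ A t ≤
      ENNReal.ofReal tileConst * innerEnergy ψ (Ioo (c - l) (c + l)) (fold c l t) := by
  set j := tileIndex c l t with hj
  have htj : t ∈ tile c l j := (mem_tile_iff hl).2 rfl
  have hm : Measurable (diffKernel ψ (fold c l t)) :=
    (measurable_diffKernel hψ).of_uncurry_left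
  let w : ℤ → ENNReal := fun n => ENNReal.ofReal (5 / (1 + (n : ℝ) ^ 2))
  calc innerEnergy ψ A t
      ≤ ∫⁻ s in A, w (tileIndex c l s - j) * diffKernel ψ (fold c l t) (fold c l s) :=
        setLIntegral_mono' hA fun s hs =>
          diffKernel_le_mul_diffKernel_fold hl ψ htj ((mem_tile_iff hl).2 rfl) (hf t ht) (hf s hs)
    _ ≤ ∫⁻ s in ⋃ k, tile c l k,
          w (tileIndex c l s - j) * diffKernel ψ (fold c l t) (fold c l s) :=
        lintegral_mono_set (by rw [iUnion_tile hl]; exact subset_univ _)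
    _ ≤ ∑' k, ∫⁻ s in tile c l k,
          w (tileIndex c l s - j) * diffKernel ψ (fold c l t) (fold c l s) :=
        lintegral_iUnion_le _ _
    _ = ∑' k, w (k - j) * innerEnergy ψ (Ioo (c - l) (c + l)) (fold c l t) := by
        refine tsum_congr fun k => ?_
        rw [innerEnergy, ← setLIntegral_tile_comp_fold hl k hm,
          ← lintegral_const_mul' _ _ ENNReal.ofReal_ne_top]
        exact setLIntegral_congr_fun measurableSet_Ico fun s hs => by
          rw [(mem_tile_iff hl).1 hs]
    _ = ENNReal.ofReal tileConst * innerEnergy ψ (Ioo (c - l) (c + l)) (fold c l t) := by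
        rw [ENNReal.tsum_mul_right, tileConst,
          ENNReal.ofReal_tsum_of_nonneg (fun n => by positivity) summable_tileWeight]
        congr 1
        exact (Equiv.subRight j).tsum_eq w

/-- Finiteness of the inner integral is inherited by the folded point: near `t` the fold is an
isometry, and away from `t` the kernel is bounded by the squared increment. -/
lemma innerEnergy_fold_lt_top {c l : ℝ} (hl : 0 < l) {ψ : ℝ → ℝ} (hψ : Measurable ψ) {a b : ℝ}
    (hf : ∀ t ∈ Ioo a b, ψ (fold c l t) = ψ t) (hT : Ioo (c - l) (c + l) ⊆ Ioo a b) {t : ℝ}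
    (ht : t ∈ Ioo a b) {k : ℤ} (htk : t ∈ Ioo (c + (2 * k - 1) * l) (c + (2 * k + 1) * l))
    (hfin : innerEnergy ψ (Ioo a b) t < ⊤) :
    innerEnergy ψ (Ioo (c - l) (c + l)) (fold c l t) < ⊤ := by
  have hm : Measurable (diffKernel ψ (fold c l t)) :=
    (measurable_diffKernel hψ).of_uncurry_left
  have hmt : Measurable (diffKernel ψ t) := (measurable_diffKernel hψ).of_uncurry_left
  obtain ⟨δ, hδ, hball⟩ := Metric.isOpen_iff.1 isOpen_Ioo t ht
  have hsq : Measurable fun x => ENNReal.ofReal ((ψ t - ψ x) ^ 2) := by fun_prop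
  have hL2 : ∫⁻ x in Ioo (c - l) (c + l), ENNReal.ofReal ((ψ t - ψ x) ^ 2) ≤
      ENNReal.ofReal ((b - a) ^ 2) * innerEnergy ψ (Ioo a b) t := by
    rw [innerEnergy, ← lintegral_const_mul _ hmt]
    refine (lintegral_mono_set hT).trans (setLIntegral_mono' measurableSet_Ioo fun x hx => ?_)
    unfold diffKernel
    rw [← ENNReal.ofReal_mul (by positivity)]
    apply ENNReal.ofReal_le_ofReal
    by_cases hxt : t = x
    · simp [hxt]
    · have h1 : 0 < (t - x) ^ 2 := by
        have := sub_ne_zero.2 hxt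
        positivity
      have h2 : (t - x) ^ 2 ≤ (b - a) ^ 2 := by
        apply sq_le_sq'  <;> linarith [ht.1, ht.2, hx.1, hx.2]
      rw [← mul_div_assoc, le_div_iff₀ h1, mul_comm]
      gcongr
  have hpt : ∀ s ∈ tile c l k, diffKernel ψ (fold c l t) (fold c l s) ≤
      (Ioo a b).indicator (diffKernel ψ t) s +
        ENNReal.ofReal ((δ ^ 2)⁻¹) * ENNReal.ofReal ((ψ t - ψ (fold c l s)) ^ 2) := by
    intro s hs
    have hd : (fold c l t - fold c l s) ^ 2 = (t - s) ^ 2 := by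
      rw [fold_eq_of_mem_tile hl (Ioo_subset_Ico_self htk), fold_eq_of_mem_tile hl hs]
      rcases neg_one_zpow_eq_or k with h | h <;> rw [h] <;> ring
    by_cases hst : dist s t < δ
    · have hsA : s ∈ Ioo a b := hball hst
      refine le_add_right (le_of_eq ?_)
      rw [indicator_of_mem hsA, diffKernel, diffKernel, hd, hf t ht, hf s hsA]
    · refine le_add_left ?_
      rw [diffKernel, ← ENNReal.ofReal_mul (by positivity), hd, hf t ht, div_eq_inv_mul]
      apply ENNReal.ofReal_le_ofReal
      rw [not_lt, Real.dist_eq, abs_sub_comm] at hst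
      rw [← sq_abs (t - s)]
      gcongr
  calc innerEnergy ψ (Ioo (c - l) (c + l)) (fold c l t)
      = ∫⁻ s in tile c l k, diffKernel ψ (fold c l t) (fold c l s) :=
        (setLIntegral_tile_comp_fold hl k hm).symm
    _ ≤ ∫⁻ s in tile c l k, ((Ioo a b).indicator (diffKernel ψ t) s +
        ENNReal.ofReal ((δ ^ 2)⁻¹) * ENNReal.ofReal ((ψ t - ψ (fold c l s)) ^ 2)) :=
        setLIntegral_mono' measurableSet_Ico hpt
    _ = (∫⁻ s in tile c l k, (Ioo a b).indicator (diffKernel ψ t) s) +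
        ENNReal.ofReal ((δ ^ 2)⁻¹) *
          ∫⁻ x in Ioo (c - l) (c + l), ENNReal.ofReal ((ψ t - ψ x) ^ 2) := by
        rw [lintegral_add_left (hmt.indicator measurableSet_Ioo),
          lintegral_const_mul' _ _ ENNReal.ofReal_ne_top,
          ← setLIntegral_tile_comp_fold hl k hsq]
    _ ≤ innerEnergy ψ (Ioo a b) t + ENNReal.ofReal ((δ ^ 2)⁻¹) *
          (ENNReal.ofReal ((b - a) ^ 2) * innerEnergy ψ (Ioo a b) t) := by
        gcongr
        refine (setLIntegral_le_lintegral _ _).trans_eq ?_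
        rw [lintegral_indicator measurableSet_Ioo, innerEnergy]
    _ < ⊤ := by
        refine ENNReal.add_lt_top.2 ⟨hfin, ENNReal.mul_lt_top ENNReal.ofReal_lt_top
          (ENNReal.mul_lt_top ENNReal.ofReal_lt_top hfin)⟩

lemma setLIntegral_comp_fold_le {c l : ℝ} (hl : 0 < l) {a b : ℝ}
    (hT : Ioo (c - l) (c + l) ⊆ Ioo a b) {h : ℝ → ENNReal} (hh : Measurable h) :
    ∫⁻ t in Ioo a b, h (fold c l t) ≤
      ENNReal.ofReal (3 * (b - a) / (2 * l)) * ∫⁻ x in Ioo (c - l) (c + l), h x := by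
  obtain ⟨h1, h2⟩ := (Ioo_subset_Ioo_iff (by linarith)).1 hT
  set i := tileIndex c l a with hi
  set j := tileIndex c l b with hj
  have hai : a ∈ tile c l i := (mem_tile_iff hl).2 rfl
  have hbj : b ∈ tile c l j := (mem_tile_iff hl).2 rfl
  have hmono : ∀ {x y : ℝ}, x ≤ y → tileIndex c l x ≤ tileIndex c l y := fun hxy => by
    unfold tileIndex
    gcongr
  have hij : i ≤ j := hmono (by linarith)
  have hcover : Ioo a b ⊆ ⋃ k ∈ Finset.Icc i j, tile c l k := fun t ht => by
    simp only [mem_iUnion, Finset.mem_Icc, exists_prop]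
    exact ⟨tileIndex c l t, ⟨hmono ht.1.le, hmono ht.2.le⟩, (mem_tile_iff hl).2 rfl⟩
  calc ∫⁻ t in Ioo a b, h (fold c l t)
      ≤ ∫⁻ t in ⋃ k ∈ Finset.Icc i j, tile c l k, h (fold c l t) := lintegral_mono_set hcover
    _ = ∑ k ∈ Finset.Icc i j, ∫⁻ t in tile c l k, h (fold c l t) := by
        refine lintegral_biUnion_finset ?_ (fun _ _ => measurableSet_Ico) _
        intro p _ q _ hpq
        exact Set.disjoint_left.2 fun x hp hq =>
          hpq (((mem_tile_iff hl).1 hp).symm.trans ((mem_tile_iff hl).1 hq))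
    _ = ENNReal.ofReal ((j + 1 - i : ℤ) : ℝ) * ∫⁻ x in Ioo (c - l) (c + l), h x := by
        simp_rw [setLIntegral_tile_comp_fold hl _ hh]
        rw [Finset.sum_const, Int.card_Icc, nsmul_eq_mul]
        congr 1
        lift j + 1 - i to ℕ using by linarith with n
        simp
    _ ≤ _ := by
        gcongr
        rw [le_div_iff₀ (by positivity)]
        push_cast
        linarith [hai.2, hbj.1]

/-- The bound on `(a, b)` for a function which is on `(a, b)` an unfolding of its restriction to
a subinterval. -/
lemma integral_le_of_comp_fold_eq {c l : ℝ} (hl : 0 < l) {ψ : ℝ → ℝ} (hψ : Measurable ψ) {a b : ℝ}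
    (hf : ∀ t ∈ Ioo a b, ψ (fold c l t) = ψ t) (hT : Ioo (c - l) (c + l) ⊆ Ioo a b) {M : ℝ}
    (hM : ∫ t in Ioo (c - l) (c + l), ∫ s in Ioo (c - l) (c + l), (ψ t - ψ s) ^ 2 / (t - s) ^ 2 ≤
      M * (2 * l)) :
    ∫ t in Ioo a b, ∫ s in Ioo a b, (ψ t - ψ s) ^ 2 / (t - s) ^ 2 ≤
      3 * tileConst * M * (b - a) := by
  obtain ⟨h1, h2⟩ := (Ioo_subset_Ioo_iff (by linarith)).1 hT
  have hab : 0 < b - a := by linarith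
  have hC := tileConst_pos
  rw [integral_integral_eq_toReal hψ] at hM ⊢
  set T := Ioo (c - l) (c + l) with hTdef
  set A := Ioo a b with hAdef
  have hM0 : 0 ≤ M := by
    have := ENNReal.toReal_nonneg.trans hM
    exact nonneg_of_mul_nonneg_left this (by positivity)
  by_cases hfin : ∫⁻ t in A, ENNReal.ofReal (innerEnergy ψ A t).toReal = ⊤
  · rw [hfin, ENNReal.toReal_top]; positivity
  have hle : ∀ t ∈ A, innerEnergy ψ A t ≤ ENNReal.ofReal tileConst * innerEnergy ψ T (fold c l t) :=
    fun t ht => innerEnergy_le_mul_innerEnergy_fold hl hψ measurableSet_Ioo hf ht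
  have hTfin : ∫⁻ t in T, ENNReal.ofReal (innerEnergy ψ T t).toReal ≠ ⊤ := by
    refine ne_top_of_le_ne_top hfin (le_trans ?_ (lintegral_mono_set hT))
    refine setLIntegral_mono' measurableSet_Ioo fun t ht => ?_
    have hft : fold c l t = t := fold_eq_self hl (Ioo_subset_Icc_self ht)
    have h := hle t (hT ht)
    rw [hft] at h
    by_cases hA : innerEnergy ψ A t = ⊤
    · have : innerEnergy ψ T t = ⊤ := by
        by_contra hne
        rw [hA, top_le_iff] at h
        exact ENNReal.mul_ne_top ENNReal.ofReal_ne_top hne h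
      simp [this]
    · exact ENNReal.ofReal_le_ofReal (ENNReal.toReal_mono hA (lintegral_mono_set hT))
  have hae : ∀ᵐ t ∂volume, t ∈ A → ENNReal.ofReal (innerEnergy ψ A t).toReal ≤
      ENNReal.ofReal tileConst * ENNReal.ofReal (innerEnergy ψ T (fold c l t)).toReal := by
    have hnull : volume (range fun k : ℤ => c + (2 * (k : ℝ) - 1) * l) = 0 :=
      (countable_range _).measure_zero _
    filter_upwards [measure_eq_zero_iff_ae_notMem.1 hnull] with t ht htA
    by_cases hA : innerEnergy ψ A t = ⊤
    · simp [hA]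
    have htk : t ∈ tile c l (tileIndex c l t) := (mem_tile_iff hl).2 rfl
    have hlt := innerEnergy_fold_lt_top hl hψ hf hT htA
      ⟨lt_of_le_of_ne htk.1 fun h => ht ⟨_, h⟩, htk.2⟩ (lt_top_iff_ne_top.2 hA)
    rw [ENNReal.ofReal_toReal hA, ENNReal.ofReal_toReal hlt.ne]
    exact hle t htA
  have hmeas : Measurable fun t => ENNReal.ofReal (innerEnergy ψ T t).toReal :=
    (measurable_innerEnergy hψ T).ennreal_toReal.ennreal_ofReal
  have hchain : ∫⁻ t in A, ENNReal.ofReal (innerEnergy ψ A t).toReal ≤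
      ENNReal.ofReal (3 * tileConst * M * (b - a)) := by
    calc ∫⁻ t in A, ENNReal.ofReal (innerEnergy ψ A t).toReal
        ≤ ∫⁻ t in A, ENNReal.ofReal tileConst *
            ENNReal.ofReal (innerEnergy ψ T (fold c l t)).toReal :=
          setLIntegral_mono_ae' measurableSet_Ioo hae
      _ = ENNReal.ofReal tileConst *
            ∫⁻ t in A, ENNReal.ofReal (innerEnergy ψ T (fold c l t)).toReal :=
          lintegral_const_mul _ (hmeas.comp (measurable_fold c l))
      _ ≤ ENNReal.ofReal tileConst * (ENNReal.ofReal (3 * (b - a) / (2 * l)) *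
            ∫⁻ t in T, ENNReal.ofReal (innerEnergy ψ T t).toReal) := by
          gcongr
          exact setLIntegral_comp_fold_le hl hT hmeas
      _ ≤ ENNReal.ofReal tileConst * (ENNReal.ofReal (3 * (b - a) / (2 * l)) *
            ENNReal.ofReal (M * (2 * l))) := by
          gcongr
          rw [← ENNReal.ofReal_toReal hTfin]
          exact ENNReal.ofReal_le_ofReal hM
      _ = ENNReal.ofReal (3 * tileConst * M * (b - a)) := by
          rw [← ENNReal.ofReal_mul (by positivity), ← ENNReal.ofReal_mul hC.le]
          congr 1
          field_simp
  exact ENNReal.toReal_le_of_le_ofReal (by positivity) hchain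

lemma integral_comp_fold_le_of_subset_tile {R : ℝ} (hR : 0 < R) {φ : ℝ → ℝ} {M : ℝ}
    (hφ : ∀ a b : ℝ, -R ≤ a → a < b → b ≤ R →
      (1 / (b - a)) * ∫ t in Ioo a b, ∫ s in Ioo a b, (φ t - φ s) ^ 2 / (t - s) ^ 2 ≤ M)
    {a b : ℝ} (hab : a < b) {k : ℤ} (ha : (2 * k - 1) * R ≤ a) (hb : b ≤ (2 * k + 1) * R) :
    ∫ t in Ioo a b, ∫ s in Ioo a b,
      ((φ ∘ fold 0 R) t - (φ ∘ fold 0 R) s) ^ 2 / (t - s) ^ 2 ≤ M * (b - a) := by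
  have key : ∀ (σ : ℝ → ℝ) (a' b' : ℝ), MeasurePreserving σ volume volume →
      MeasurableEmbedding σ → (∀ t s, (σ t - σ s) ^ 2 = (t - s) ^ 2) →
      (∀ t ∈ Ioo a b, fold 0 R t = σ t) → σ ⁻¹' Ioo a' b' = Ioo a b →
      -R ≤ a' → b' ≤ R → b' - a' = b - a →
      ∫ t in Ioo a b, ∫ s in Ioo a b,
        ((φ ∘ fold 0 R) t - (φ ∘ fold 0 R) s) ^ 2 / (t - s) ^ 2 ≤ M * (b - a) := by
    intro σ a' b' hσ hemb hiso hf hpre ha' hb' hlen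
    have hφ' := hφ a' b' ha' (by linarith) hb'
    rw [one_div, inv_mul_le_iff₀ (by linarith), hlen, mul_comm] at hφ'
    refine le_trans (le_of_eq ?_) hφ'
    rw [← hσ.setIntegral_preimage_emb hemb _ (Ioo a' b'), hpre]
    refine setIntegral_congr_fun measurableSet_Ioo fun t ht => ?_
    rw [← hσ.setIntegral_preimage_emb hemb _ (Ioo a' b'), hpre]
    refine setIntegral_congr_fun measurableSet_Ioo fun s hs => ?_
    simp only [Function.comp, hf t ht, hf s hs, hiso]
  have hfold : ∀ t ∈ Ioo a b, fold 0 R t = (-1 : ℝ) ^ k * (t - 2 * k * R) := fun t ht => by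
    rw [fold_eq_of_mem_Icc hR (k := k) ⟨by linarith [ht.1], by linarith [ht.2]⟩]
    ring
  rcases neg_one_zpow_eq_or k with hk | hk
  · refine key (fun t => t - 2 * k * R) (a - 2 * k * R) (b - 2 * k * R)
      (measurePreserving_sub_right volume _) (measurableEmbedding_subRight _)
      (fun t s => by ring) (fun t ht => by rw [hfold t ht, hk]; ring) ?_
      (by linarith) (by linarith) (by ring)
    rw [preimage_sub_const_Ioo]; congr 1 <;> ring
  · refine key (fun t => 2 * k * R - t) (2 * k * R - b) (2 * k * R - a)
      (Measure.measurePreserving_sub_left volume _) (measurableEmbedding_subLeft _)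
      (fun t s => by ring) (fun t ht => by rw [hfold t ht, hk]; ring) ?_
      (by linarith) (by linarith) (by ring)
    rw [preimage_const_sub_Ioo]; congr 1 <;> ring

lemma fold_reflect {R t : ℝ} (hR : 0 < R) (k : ℤ) :
    fold 0 R (2 * ((2 * k + 1) * R) - t) = fold 0 R t := by
  set j := tileIndex 0 R t
  have ht : t ∈ tile 0 R j := (mem_tile_iff hR).2 rfl
  have ht' : 2 * ((2 * k + 1) * R) - t ∈
      Icc (0 + (2 * ((2 * k + 1 - j : ℤ) : ℝ) - 1) * R)
        (0 + (2 * ((2 * k + 1 - j : ℤ) : ℝ) + 1) * R) := by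
    push_cast
    constructor <;> linarith [ht.1, ht.2]
  rw [fold_eq_of_mem_tile hR ht, fold_eq_of_mem_Icc hR ht', zpow_sub₀ (by norm_num),
    (odd_two_mul_add_one k).neg_one_zpow]
  rcases neg_one_zpow_eq_or j with h | h <;> rw [h] <;> push_cast <;> ring

lemma fold_fold_tile {R : ℝ} (hR : 0 < R) (k : ℤ) (t : ℝ) :
    fold 0 R (fold (2 * k * R) R t) = fold 0 R t := by
  set j := tileIndex (2 * k * R) R t
  have ht : t ∈ tile (2 * k * R) R j := (mem_tile_iff hR).2 rfl
  have hs := fold_eq_of_mem_tile hR ht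
  have h1 := ht.1
  have h2 := ht.2
  have htk : t ∈ tile 0 R (k + j) := by
    constructor <;> push_cast <;> linarith
  have hsk : fold (2 * k * R) R t ∈ Icc (0 + (2 * (k : ℝ) - 1) * R) (0 + (2 * (k : ℝ) + 1) * R) := by
    rw [hs]
    rcases neg_one_zpow_eq_or j with h | h <;> rw [h] <;> constructor <;> linarith
  rw [fold_eq_of_mem_Icc hR hsk, fold_eq_of_mem_tile hR htk, hs, zpow_add₀ (by norm_num)]
  push_cast
  ring

/-- If
`sup_{I ⊆ [−r²,r²]} |I|⁻¹ ∫_I∫_I |φ(t)−φ(τ)|²/|t−τ|² ≤ η²`, then the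
reflected–tiled extension `φ̃` satisfies the same bound `C η²` on every
bounded interval, with an absolute constant `C`. -/
theorem stmt10 : ∃ C : ℝ, 0 < C ∧ ∀ (r : ℝ), 0 < r → ∀ φ : ℝ → ℝ, Measurable φ →
    ∀ η : ℝ,
      (∀ a b : ℝ, -r ^ 2 ≤ a → a < b → b ≤ r ^ 2 →
        (1 / (b - a)) * ∫ t in Ioo a b, ∫ τ in Ioo a b,
          (φ t - φ τ) ^ 2 / (t - τ) ^ 2 ≤ η ^ 2) →
      ∀ a b : ℝ, a < b →
        (1 / (b - a)) * ∫ t in Ioo a b, ∫ τ in Ioo a b,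
          (tileReflect r φ t - tileReflect r φ τ) ^ 2 / (t - τ) ^ 2 ≤ C * η ^ 2 := by
  refine ⟨3 * tileConst, mul_pos (by norm_num) tileConst_pos, fun r hr φ hφm η hφ a b hab => ?_⟩
  rw [tileReflect_eq_comp_fold hr]
  have hR : 0 < r ^ 2 := by positivity
  set R := r ^ 2
  have hψ : Measurable (φ ∘ fold 0 R) := hφm.comp (measurable_fold 0 R)
  rw [one_div, inv_mul_le_iff₀ (by linarith), mul_comm (b - a)]
  -- It suffices to find a subinterval of a single tile onto which `(a, b)` folds.
  have key : ∀ (c l : ℝ) (k : ℤ), 0 < l → (∀ t ∈ Ioo a b, fold 0 R (fold c l t) = fold 0 R t) →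
      a ≤ c - l → c + l ≤ b → (2 * k - 1) * R ≤ c - l → c + l ≤ (2 * k + 1) * R →
      ∫ t in Ioo a b, ∫ s in Ioo a b,
        ((φ ∘ fold 0 R) t - (φ ∘ fold 0 R) s) ^ 2 / (t - s) ^ 2 ≤
        3 * tileConst * η ^ 2 * (b - a) := by
    intro c l k hl hf ha hb hka hkb
    refine integral_le_of_comp_fold_eq hl hψ (fun t ht => congrArg φ (hf t ht))
      (Ioo_subset_Ioo ha hb) ?_
    have h := integral_comp_fold_le_of_subset_tile hR hφ (by linarith : c - l < c + l) hka hkb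
    rwa [show c + l - (c - l) = 2 * l by ring] at h
  set k := tileIndex 0 R a
  have hak : a ∈ tile 0 R k := (mem_tile_iff hR).2 rfl
  have h1 := hak.1
  have h2 := hak.2
  rcases le_or_gt b ((2 * k + 1) * R) with hb | hb
  · refine key ((a + b) / 2) ((b - a) / 2) k (by linarith) (fun t ht => ?_) (by linarith)
      (by linarith) (by linarith) (by linarith)
    rw [fold_eq_self (c := (a + b) / 2) (l := (b - a) / 2) (by linarith) ⟨by linarith [ht.1], by linarith [ht.2]⟩]
  rcases le_or_gt b ((2 * k + 3) * R) with hb' | hb'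
  · set P := (2 * (k : ℝ) + 1) * R with hP
    rcases le_total (P - a) (b - P) with hm | hm
    · refine key ((P + b) / 2) ((b - P) / 2) (k + 1) (by linarith) (fun t ht => ?_) (by linarith)
        (by linarith) (by push_cast; linarith) (by push_cast; linarith)
      rcases le_total t P with htP | htP
      · rw [fold_eq_reflect_left (c := (P + b) / 2) (l := (b - P) / 2) (by linarith) ⟨by linarith [ht.1], by linarith⟩,
          show 2 * ((P + b) / 2 - (b - P) / 2) - t = 2 * P - t by ring, fold_reflect hR]
      · rw [fold_eq_self (c := (P + b) / 2) (l := (b - P) / 2) (by linarith) ⟨by linarith, by linarith [ht.2]⟩]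
    · refine key ((a + P) / 2) ((P - a) / 2) k (by linarith) (fun t ht => ?_) (by linarith)
        (by linarith) (by linarith) (by linarith)
      rcases le_total t P with htP | htP
      · rw [fold_eq_self (c := (a + P) / 2) (l := (P - a) / 2) (by linarith) ⟨by linarith [ht.1], by linarith⟩]
      · rw [fold_eq_reflect_right (c := (a + P) / 2) (l := (P - a) / 2) (by linarith) ⟨by linarith, by linarith [ht.2]⟩,
          show 2 * ((a + P) / 2 + (P - a) / 2) - t = 2 * P - t by ring, fold_reflect hR]
  · refine key (2 * ((k + 1 : ℤ) : ℝ) * R) R (k + 1) hR (fun t _ => fold_fold_tile hR _ t) ?_ ?_ ?_ ?_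
      <;> push_cast <;> linarith
end
end
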